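/- Let d ≥ 2 and let ρ be a d×d complex density matrix such that for some k ≠ l in Fin d one has ρ_{kk} > 0, ρ_{ll} > 0, ρ_{kk} + ρ_{ll} = 1, and ρ_{kl} ≠ 0. Let σ(ρ) be the d²×d² matrix, indexed by Fin d × Fin d, whose ((j,j),(k,k)) entry is ρ_{jk} and all other entries 0. Then there exist Hermitian d×d complex matrices A₁, A₂, B₁, B₂, each satisfying that I − A² is positive semidefinite, such that |Tr(σ(ρ) · (A₁⊗B₁ + A₁⊗B₂ + A₂⊗B₁ − A₂⊗B₂))| > 2, where ⊗ denotes the Kronecker product. -/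

import Mathlib

open Matrix Kronecker ComplexOrder

/-- The d²×d² matrix `σ(ρ) = Σ_{jk} ρ_{jk} |jj⟩⟨kk|`. -/
noncomputable def sigmaOfd (d : ℕ) (ρ : Matrix (Fin d) (Fin d) ℂ) :
    Matrix (Fin d × Fin d) (Fin d × Fin d) ℂ :=
  fun p q => if p.1 = p.2 ∧ q.1 = q.2 then ρ p.1 q.1 else 0

noncomputable def obsM {d : ℕ} (k l : Fin d) (a : ℝ) (b : ℂ) : Matrix (Fin d) (Fin d) ℂ :=
  single k k (a : ℂ) + single l l (-(a : ℂ)) + single k l b + single l k (star b)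

lemma obsM_herm {d : ℕ} (k l : Fin d) (a : ℝ) (b : ℂ) : (obsM k l a b).IsHermitian := by
  unfold obsM Matrix.IsHermitian
  simp only [conjTranspose_add, conjTranspose_single, star_star, star_neg, Complex.star_def,
    Complex.conj_ofReal, Complex.conj_conj]
  abel

lemma obsM_psd {d : ℕ} (k l : Fin d) (hkl : k ≠ l) (a : ℝ) (b : ℂ)
    (h : (a : ℂ) * a + b * star b = 1) :
    (1 - obsM k l a b * obsM k l a b).PosSemidef := by
  have e : 1 - obsM k l a b * obsM k l a b
      = diagonal (fun i => if i = k ∨ i = l then (0 : ℂ) else 1) := by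
    have h2 : obsM k l a b * obsM k l a b = single k k 1 + single l l 1 := by
      unfold obsM
      simp only [add_mul, mul_add, single_mul_single_same, single_mul_single_of_ne _ _ _ _ hkl,
        single_mul_single_of_ne _ _ _ _ hkl.symm, add_zero, zero_add]
      rw [← h]
      ext i j
      simp only [Matrix.add_apply, single_apply]
      split_ifs <;> ring
    rw [h2]
    ext i j
    simp only [Matrix.sub_apply, Matrix.add_apply, single_apply, diagonal_apply, one_apply]
    grind
  rw [e, posSemidef_diagonal_iff]
  intro i
  split_ifs <;> simp

lemma tr_single {d : ℕ} (ρ : Matrix (Fin d) (Fin d) ℂ) (i j i' j' : Fin d) (x y : ℂ) :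
    trace (sigmaOfd d ρ * (single i j x ⊗ₖ single i' j' y))
      = if j = j' ∧ i = i' then ρ j i * (x * y) else 0 := by
  rw [single_kronecker_single, trace_mul_single]
  simp [sigmaOfd]

lemma tr_obs {d : ℕ} (ρ : Matrix (Fin d) (Fin d) ℂ) (k l : Fin d) (hkl : k ≠ l)
    (a a' : ℝ) (b b' : ℂ) :
    trace (sigmaOfd d ρ * (obsM k l a b ⊗ₖ obsM k l a' b'))
      = (ρ k k + ρ l l) * (a * a') + ρ l k * (b * b') + ρ k l * (star b * star b') := by
  unfold obsM
  simp only [add_kronecker, kronecker_add, mul_add, trace_add, tr_single, hkl, hkl.symm]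
  simp
  ring

theorem stmt6 (d : ℕ) (hd : 2 ≤ d) (ρ : Matrix (Fin d) (Fin d) ℂ)
    (hρ : ρ.PosSemidef) (htr : ρ.trace = 1)
    (k l : Fin d) (hkl : k ≠ l)
    (hkk : 0 < (ρ k k).re) (hll : 0 < (ρ l l).re)
    (hsum : ρ k k + ρ l l = 1) (hcoh : ρ k l ≠ 0) :
    ∃ A₁ A₂ B₁ B₂ : Matrix (Fin d) (Fin d) ℂ,
      A₁.IsHermitian ∧ A₂.IsHermitian ∧ B₁.IsHermitian ∧ B₂.IsHermitian ∧
      (1 - A₁ * A₁).PosSemidef ∧ (1 - A₂ * A₂).PosSemidef ∧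
      (1 - B₁ * B₁).PosSemidef ∧ (1 - B₂ * B₂).PosSemidef ∧
      2 < ‖Matrix.trace (sigmaOfd d ρ *
        (A₁ ⊗ₖ B₁ + A₁ ⊗ₖ B₂ + A₂ ⊗ₖ B₁ - A₂ ⊗ₖ B₂))‖ := by
  obtain ⟨t, ht⟩ : ∃ t : ℝ, t = ‖ρ k l‖ := ⟨_, rfl⟩
  have htpos : 0 < t := by rw [ht]; exact norm_pos_iff.mpr hcoh
  have htC : (t : ℂ) ≠ 0 := by exact_mod_cast htpos.ne'
  have hlk : ρ l k = star (ρ k l) := (hρ.1.apply l k).symm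
  have hz : ρ k l * star (ρ k l) = (t : ℂ) * t := by
    rw [Complex.star_def, Complex.mul_conj, Complex.normSq_eq_norm_sq, ← ht]; push_cast; ring
  have hst : star (t : ℂ) = t := Complex.conj_ofReal t
  obtain ⟨c, hc⟩ : ∃ c : ℝ, c = (1 - t ^ 2) / (1 + t ^ 2) := ⟨_, rfl⟩
  obtain ⟨s, hs⟩ : ∃ s : ℝ, s = 2 * t / (1 + t ^ 2) := ⟨_, rfl⟩
  have hcs : c * c + s * s = 1 := by rw [hc, hs]; field_simp; ring
  have hcsC : (c : ℂ) * c + s * s = 1 := by exact_mod_cast hcs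
  have hss : star (s : ℂ) = s := Complex.conj_ofReal s
  have hbig : 1 < c + 2 * t * s := by
    have : c + 2 * t * s - 1 = 2 * t ^ 2 / (1 + t ^ 2) := by rw [hc, hs]; field_simp; ring
    have : 0 < 2 * t ^ 2 / (1 + t ^ 2) := by positivity
    linarith
  refine ⟨obsM k l 1 0, obsM k l 0 (ρ k l / t), obsM k l c s, obsM k l c (-s),
    obsM_herm .., obsM_herm .., obsM_herm .., obsM_herm ..,
    obsM_psd k l hkl _ _ (by simp), obsM_psd k l hkl _ _ ?_,
    obsM_psd k l hkl _ _ (by rw [hss, hcsC]), obsM_psd k l hkl _ _ ?_, ?_⟩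
  · rw [star_div₀, hst, div_mul_div_comm, hz]
    simp [htC]
  · rw [star_neg, hss, neg_mul_neg, hcsC]
  · have key : Matrix.trace (sigmaOfd d ρ * (obsM k l 1 0 ⊗ₖ obsM k l c s
        + obsM k l 1 0 ⊗ₖ obsM k l c (-s) + obsM k l 0 (ρ k l / t) ⊗ₖ obsM k l c s
        - obsM k l 0 (ρ k l / t) ⊗ₖ obsM k l c (-s))) = ((2 * (c + 2 * t * s) : ℝ) : ℂ) := by
      simp only [mul_add, mul_sub, trace_add, trace_sub, tr_obs ρ k l hkl, hsum, hlk, star_neg,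
        hss, star_div₀, hst, star_zero]
      push_cast
      field_simp
      linear_combination (4 * (s : ℂ)) * hz
    rw [key, Complex.norm_real, Real.norm_eq_abs]
    exact lt_of_lt_of_le (by linarith) (le_abs_self _)
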